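/- Let 𝒜 be a family of subsets of a set M with finite VC dimension VCD(𝒜), let R_1 ∈ 𝒜, let X_1, …, X_n be fixed distinct design points in M, and let Y_i = μ⁽¹⁾·1{X_i ∈ R_1} + μ⁽⁰⁾·1{X_i ∉ R_1} + ε_i for i = 1,…,n, where ε_1,…,ε_n are i.i.d. N(0, σ²) and θ := |μ⁽¹⁾ − μ⁽⁰⁾|. Suppose τ := L_n(R_1, ∅) > 0. Then there exist universal constants C_0, C_1, C_2 > 0 such that whenever n·τ·θ² > C_0 · σ² · VCD(𝒜) · log n, any maximizer R̂ of |T_A(Y)| over A ∈ 𝒜 satisfies, with probability at least 1 − C_1 · n^{−VCD(𝒜)}, the bound L_n(R̂, R_1) ≤ C_2 · σ² · VCD(𝒜) · log(n) / (n · τ · θ²). -/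

import Mathlib

open MeasureTheory ProbabilityTheory
open scoped symmDiff ENNReal NNReal

attribute [local instance] Classical.propDecidable

/-- Number of design points falling in `A`, i.e. `|A|_D`. -/
noncomputable def cnt {M : Type*} {n : ℕ} (X : Fin n → M) (A : Set M) : ℕ :=
  (Finset.univ.filter fun i => X i ∈ A).card

/-- Sum of the entries of `Z` over indices whose design point lies in `A`. -/
noncomputable def sumIn {M : Type*} {n : ℕ} (X : Fin n → M) (A : Set M) (Z : Fin n → ℝ) : ℝ :=
  ∑ i ∈ Finset.univ.filter (fun i => X i ∈ A), Z i

/-- The CUSUM statistic `T_A(Z)`, with the convention that it is `0` when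
`|A|_D = 0` or `|A^c|_D = 0`. -/
noncomputable def cusum {M : Type*} {n : ℕ} (X : Fin n → M) (A : Set M) (Z : Fin n → ℝ) : ℝ :=
  if cnt X A = 0 ∨ cnt X Aᶜ = 0 then 0
  else Real.sqrt ((cnt X A : ℝ) * (cnt X Aᶜ : ℝ) / (n : ℝ)) *
    (sumIn X A Z / (cnt X A : ℝ) - sumIn X Aᶜ Z / (cnt X Aᶜ : ℝ))

/-- The in-sample loss `L_n(A, B) = (1/n) * min(|A △ B|_D, |A △ B^c|_D)`. -/
noncomputable def lossN {M : Type*} {n : ℕ} (X : Fin n → M) (A B : Set M) : ℝ :=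
  (1 / (n : ℝ)) * min ((cnt X (A ∆ B) : ℝ)) ((cnt X (A ∆ Bᶜ) : ℝ))

/-- A family `𝒜` of subsets of `Ω` shatters a finite set `S ⊆ Ω` if
`{S ∩ A : A ∈ 𝒜}` is the whole power set of `S`. -/
def Shatters {Ω : Type*} (𝒜 : Set (Set Ω)) (S : Finset Ω) : Prop :=
  ∀ T : Finset Ω, T ⊆ S → ∃ A ∈ 𝒜, (S : Set Ω) ∩ A = (T : Set Ω)

/-- The VC dimension of a family of sets: the supremum of the cardinalities of
finite shattered subsets, as an extended natural number. -/
noncomputable def VCD {Ω : Type*} (𝒜 : Set (Set Ω)) : ℕ∞ :=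
  ⨆ S ∈ {S : Finset Ω | Shatters 𝒜 S}, (S.card : ℕ∞)

/-! Helper lemmas. -/

lemma aux_tail {n : ℕ} (σ : ℝ) (hσ : 0 < σ) (w : ℝ≥0) (hw : (w : ℝ) = σ ^ 2) (z : Fin n → ℝ) (t : ℝ) (ht : 0 ≤ t) :
    (Measure.pi fun _ : Fin n => gaussianReal 0 w)
      {ε : Fin n → ℝ | σ * Real.sqrt ((∑ i, z i ^ 2) * (2 * t)) < ∑ i, z i * ε i}
      ≤ ENNReal.ofReal (Real.exp (-t)) := by
  set P := (Measure.pi fun _ : Fin n => gaussianReal 0 w) with hP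
  by_cases hz : ∑ i, z i ^ 2 = 0
  · have hz0 : ∀ i, z i = 0 := by
      intro i
      have := (Finset.sum_eq_zero_iff_of_nonneg (fun i _ => sq_nonneg (z i))).1 hz i (Finset.mem_univ i)
      exact pow_eq_zero_iff (two_ne_zero) |>.1 this
    simp [hz0]
  have hzpos : 0 < ∑ i, z i ^ 2 :=
    lt_of_le_of_ne (Finset.sum_nonneg (fun i _ => sq_nonneg (z i))) (Ne.symm hz)
  have hind : iIndepFun (fun i (ω : Fin n → ℝ) => z i * ω i) P :=
    iIndepFun_pi (X := fun i x => z i * x) (fun i => by fun_prop)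
  have hsub : ∀ i ∈ (Finset.univ : Finset (Fin n)), HasSubgaussianMGF (fun ω : Fin n → ℝ => z i * ω i)
      (NNReal.mk (z i ^ 2) (sq_nonneg _) * w) P := by
    intro i _
    apply HasSubgaussianMGF.const_mul
    have hmap : P.map (fun ω => ω i) = gaussianReal 0 w :=
      (measurePreserving_eval _ i).map_eq
    refine HasSubgaussianMGF.of_map (Y := fun ω : Fin n → ℝ => ω i) (X := fun x => x)
      (measurable_pi_apply i).aemeasurable ?_
    rw [hmap]
    refine ⟨fun t => integrable_exp_mul_gaussianReal t, fun t => ?_⟩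
    rw [mgf_fun_id_gaussianReal]
    simp
  have hb := HasSubgaussianMGF.measure_sum_ge_le_of_iIndepFun hind hsub
    (ε := σ * Real.sqrt ((∑ i, z i ^ 2) * (2 * t))) (by positivity)
  have he : -(σ * Real.sqrt ((∑ i, z i ^ 2) * (2 * t))) ^ 2 /
      (2 * (((∑ i, (NNReal.mk (z i ^ 2) (sq_nonneg _) * w)) : ℝ≥0) : ℝ)) = -t := by
    have h1 : (((∑ i, (NNReal.mk (z i ^ 2) (sq_nonneg _) * w)) : ℝ≥0) : ℝ)
        = (∑ i, z i ^ 2) * σ ^ 2 := by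
      push_cast
      rw [Finset.sum_mul]
      simp only [hw]
    rw [h1, mul_pow, Real.sq_sqrt (by positivity)]
    field_simp
  rw [he] at hb
  refine (measure_mono ?_).trans (ENNReal.le_ofReal_iff_toReal_le (measure_ne_top _ _) (by positivity) |>.2 hb)
  intro ω hω
  simp only [Set.mem_ofPred_eq] at hω ⊢
  exact hω.le

lemma aux_ineq (p q r t : ℝ) (hp : 0 ≤ p) (hq : 0 ≤ q) (hr : 0 ≤ r) (ht : 0 ≤ t)
    (hR : 0 < p + r) (hS : 0 < q + t) :
    (p + q) * (r + t) * min (q + r) (p + t) ≤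
      (p + q + r + t) ^ 2 * (p * r / (p + r) + q * t / (q + t)) := by
  have key : ∀ x y : ℝ, 0 ≤ x → 0 ≤ y → 0 < x + y → x ≤ y → x / 2 ≤ x * y / (x + y) := by
    intro x y hx hy h hxy
    rw [div_le_div_iff₀ two_pos h]
    nlinarith
  have key' : ∀ x y : ℝ, 0 ≤ x → 0 ≤ y → 0 < x + y → y ≤ x → y / 2 ≤ x * y / (x + y) := by
    intro x y hx hy h hxy
    rw [div_le_div_iff₀ two_pos h]
    nlinarith
  have hm1 := min_le_left (q + r) (p + t)
  have hm2 := min_le_right (q + r) (p + t)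
  have hm0 : 0 ≤ min (q + r) (p + t) := le_min (by positivity) (by positivity)
  set m := min (q + r) (p + t)
  set E := p * r / (p + r) + q * t / (q + t) with hE
  have hN : 0 < p + q + r + t := by linarith
  set N := p + q + r + t with hNd
  have hab : (p + q) * (r + t) ≤ N ^ 2 / 4 := by rw [hNd]; nlinarith [sq_nonneg (p + q - r - t)]
  have hmN : m ≤ N / 2 := by linarith
  have c1 : m / 2 ≤ E → (p + q) * (r + t) * m ≤ N ^ 2 * E := by
    intro h
    have := mul_le_mul_of_nonneg_right hab hm0
    nlinarith [sq_nonneg N, mul_le_mul_of_nonneg_left h (sq_nonneg N), mul_nonneg (sq_nonneg N) hm0]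
  have c2 : (r + t) / 2 ≤ E → (p + q) * (r + t) * m ≤ N ^ 2 * E := by
    intro h
    calc (p + q) * (r + t) * m ≤ N * (r + t) * (N / 2) := by
          gcongr; linarith
      _ = N ^ 2 * ((r + t) / 2) := by ring
      _ ≤ N ^ 2 * E := by gcongr
  have c3 : (p + q) / 2 ≤ E → (p + q) * (r + t) * m ≤ N ^ 2 * E := by
    intro h
    calc (p + q) * (r + t) * m ≤ (p + q) * N * (N / 2) := by
          gcongr; linarith
      _ = N ^ 2 * ((p + q) / 2) := by ring
      _ ≤ N ^ 2 * E := by gcongr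
  rcases le_total p r with h1 | h1 <;> rcases le_total q t with h2 | h2
  · apply c3; linarith [key p r hp hr hR h1, key q t hq ht hS h2]
  · apply c1; linarith [key p r hp hr hR h1, key' q t hq ht hS h2]
  · apply c1; linarith [key' p r hp hr hR h1, key q t hq ht hS h2]
  · apply c2; linarith [key' p r hp hr hR h1, key' q t hq ht hS h2]

/-- trace of a set on the design -/
noncomputable def trc {M : Type*} {n : ℕ} (X : Fin n → M) (A : Set M) : Finset (Fin n) :=
  Finset.univ.filter fun i => X i ∈ A

/-- family of traces -/
noncomputable def trcs {M : Type*} {n : ℕ} (X : Fin n → M) (𝒜 : Set (Set M)) : Finset (Finset (Fin n)) :=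
  Finset.univ.filter fun T => ∃ A ∈ 𝒜, trc X A = T

lemma aux_sum_choose (n v : ℕ) : ∑ k ∈ Finset.Iic v, n.choose k ≤ (n + 1) ^ v := by
  rw [add_pow]
  have : Finset.Iic v = Finset.range (v + 1) := by ext; simp
  rw [this]
  apply Finset.sum_le_sum
  intro k hk
  have hk' : k ≤ v := by simpa [Nat.lt_succ_iff] using hk
  simp only [one_pow, mul_one]
  calc n.choose k ≤ n ^ k := Nat.choose_le_pow _ _
    _ ≤ n ^ k * v.choose k := Nat.le_mul_of_pos_right _ (Nat.choose_pos hk')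

lemma aux_sauer {M : Type*} {n : ℕ} (X : Fin n → M) (hX : Function.Injective X)
    (𝒜 : Set (Set M)) (v : ℕ) (hv : VCD 𝒜 = (v : ℕ∞)) :
    (trcs X 𝒜).card ≤ (n + 1) ^ v := by
  have hvc : (trcs X 𝒜).vcDim ≤ v := by
    apply Finset.sup_le
    intro S hS
    rw [Finset.mem_shatterer] at hS
    have hsh : Shatters 𝒜 (S.map ⟨X, hX⟩) := by
      intro T hT
      have hsub : S.filter (fun i => X i ∈ T) ⊆ S := Finset.filter_subset _ _
      obtain ⟨U, hU, hSU⟩ := hS hsub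
      obtain ⟨A, hA, rfl⟩ := (Finset.mem_filter.1 hU).2
      refine ⟨A, hA, ?_⟩
      ext x
      constructor
      · rintro ⟨hx1, hx2⟩
        simp only [Finset.coe_map, Function.Embedding.coeFn_mk, Set.mem_image, Finset.mem_coe] at hx1
        obtain ⟨i, hi, rfl⟩ := hx1
        have : i ∈ S ∩ trc X A := by simp [trc, hi, hx2]
        rw [hSU] at this
        exact (Finset.mem_filter.1 this).2
      · intro hx
        have hx' := hT hx
        simp only [Finset.mem_map, Function.Embedding.coeFn_mk] at hx'
        obtain ⟨i, hi, rfl⟩ := hx'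
        have : i ∈ S ∩ trc X A := by
          rw [hSU]; exact Finset.mem_filter.2 ⟨hi, hx⟩
        simp only [trc, Finset.mem_inter, Finset.mem_filter, Finset.mem_univ, true_and] at this
        refine ⟨?_, this.2⟩
        simp only [Finset.coe_map, Function.Embedding.coeFn_mk, Set.mem_image, Finset.mem_coe]
        exact ⟨i, hi, rfl⟩
    have h2 : ((S.map ⟨X, hX⟩).card : ℕ∞) ≤ VCD 𝒜 :=
      le_iSup₂ (f := fun (S : Finset M) (_ : S ∈ {S : Finset M | Shatters 𝒜 S}) => (S.card : ℕ∞)) _ hsh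
    rw [hv, Finset.card_map] at h2
    exact_mod_cast h2
  calc (trcs X 𝒜).card ≤ _ := Finset.card_le_card_shatterer _
    _ ≤ _ := Finset.card_shatterer_le_sum_vcDim
    _ ≤ ∑ k ∈ Finset.Iic v, n.choose k := by
      simp only [Fintype.card_fin]
      exact Finset.sum_le_sum_of_subset (Finset.Iic_subset_Iic.2 hvc)
    _ ≤ _ := aux_sum_choose n v

/-- indicator -/
noncomputable def ind {n : ℕ} (T : Finset (Fin n)) (i : Fin n) : ℝ := if i ∈ T then 1 else 0

/-- scale -/
noncomputable def sc {n : ℕ} (T : Finset (Fin n)) : ℝ :=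
  Real.sqrt ((T.card : ℝ) * ((n : ℝ) - T.card) / n)

/-- contrast vector -/
noncomputable def uv {n : ℕ} (T : Finset (Fin n)) (i : Fin n) : ℝ :=
  (ind T i - (T.card : ℝ) / n) / sc T

lemma card_le_n {n : ℕ} (T : Finset (Fin n)) : (T.card : ℝ) ≤ n := by
  have := Finset.card_le_univ T
  simp only [Fintype.card_fin] at this
  exact_mod_cast this

lemma sc_sq {n : ℕ} (T : Finset (Fin n)) : sc T ^ 2 = (T.card : ℝ) * ((n : ℝ) - T.card) / n := by
  unfold sc
  have := card_le_n T
  rw [Real.sq_sqrt]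
  have : 0 ≤ (n : ℝ) - T.card := by linarith
  positivity

lemma sum_ind_mul {n : ℕ} (T : Finset (Fin n)) (f : Fin n → ℝ) :
    ∑ i, ind T i * f i = ∑ i ∈ T, f i := by
  simp [ind, Finset.sum_ite_mem]

lemma sum_ind {n : ℕ} (T : Finset (Fin n)) : ∑ i, ind T i = T.card := by
  have := sum_ind_mul T (fun _ => 1)
  simpa using this

lemma sum_ind_ind {n : ℕ} (T R : Finset (Fin n)) :
    ∑ i, ind T i * ind R i = ((T ∩ R).card : ℝ) := by
  rw [sum_ind_mul]
  simp [ind]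

lemma sum_uv_mul {n : ℕ} (T : Finset (Fin n)) (f : Fin n → ℝ) :
    ∑ i, uv T i * f i = (∑ i ∈ T, f i - (T.card : ℝ) / n * ∑ i, f i) / sc T := by
  rw [← sum_ind_mul T f, Finset.mul_sum, ← Finset.sum_sub_distrib, Finset.sum_div]
  apply Finset.sum_congr rfl
  intro i _
  unfold uv
  ring

lemma sum_uv {n : ℕ} (hn : 0 < n) (T : Finset (Fin n)) : ∑ i, uv T i = 0 := by
  have := sum_uv_mul T (fun _ => 1)
  have hn' : (n : ℝ) ≠ 0 := by positivity
  simp only [mul_one, Finset.sum_const, nsmul_eq_mul, Finset.card_univ, Fintype.card_fin] at this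
  rw [this]
  field_simp
  simp

lemma sum_uv_uv {n : ℕ} (hn : 0 < n) (T R : Finset (Fin n)) :
    ∑ i, uv T i * uv R i =
      (((T ∩ R).card : ℝ) - (T.card : ℝ) * R.card / n) / (sc T * sc R) := by
  rw [sum_uv_mul, sum_uv hn, ← sum_ind_mul]
  have : ∑ i, ind T i * uv R i = (((T ∩ R).card : ℝ) - (T.card : ℝ) * R.card / n) / sc R := by
    rw [← sum_ind_ind, ← sum_ind T, Finset.sum_mul, Finset.sum_div, ← Finset.sum_sub_distrib,
      Finset.sum_div]
    apply Finset.sum_congr rfl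
    intro i _
    unfold uv
    ring
  rw [this, mul_zero, sub_zero, div_div, mul_comm (sc R)]

lemma sum_uv_sq {n : ℕ} (hn : 0 < n) (T : Finset (Fin n)) :
    ∑ i, uv T i ^ 2 = sc T ^ 2 / sc T ^ 2 := by
  have := sum_uv_uv hn T T
  have hn' : (n : ℝ) ≠ 0 := by positivity
  simp only [← sq] at this
  rw [this]
  congr 1
  rw [sc_sq, Finset.inter_self]
  field_simp

lemma sum_uv_sq_le {n : ℕ} (hn : 0 < n) (T : Finset (Fin n)) : ∑ i, uv T i ^ 2 ≤ 1 := by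
  rw [sum_uv_sq hn]
  exact div_self_le_one _

lemma trc_card {M : Type*} {n : ℕ} (X : Fin n → M) (A : Set M) : cnt X A = (trc X A).card := rfl

lemma trc_compl {M : Type*} {n : ℕ} (X : Fin n → M) (A : Set M) : trc X Aᶜ = (trc X A)ᶜ := by
  ext i; simp [trc]

lemma cnt_compl {M : Type*} {n : ℕ} (X : Fin n → M) (A : Set M) :
    (cnt X Aᶜ : ℝ) = n - (trc X A).card := by
  rw [trc_card, trc_compl, Finset.card_compl, Nat.cast_sub (Finset.card_le_univ _)]
  simp

lemma sumIn_compl {M : Type*} {n : ℕ} (X : Fin n → M) (A : Set M) (Z : Fin n → ℝ) :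
    sumIn X Aᶜ Z = ∑ i, Z i - ∑ i ∈ trc X A, Z i := by
  have : sumIn X Aᶜ Z = ∑ i ∈ trc X Aᶜ, Z i := rfl
  rw [this, trc_compl, eq_sub_iff_add_eq, Finset.sum_compl_add_sum]

lemma cusum_eq {M : Type*} {n : ℕ} (hn : 0 < n) (X : Fin n → M) (A : Set M) (Z : Fin n → ℝ) :
    cusum X A Z = ∑ i, uv (trc X A) i * Z i := by
  have hn' : (0 : ℝ) < n := by positivity
  rw [sum_uv_mul]
  unfold cusum
  have e1 : sumIn X A Z = ∑ i ∈ trc X A, Z i := rfl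
  have hc1 := cnt_compl X A
  have hc0 : (cnt X A : ℝ) = (trc X A).card := rfl
  have hs2 := sc_sq (trc X A)
  have hsd : Real.sqrt (((trc X A).card : ℝ) * ((n : ℝ) - (trc X A).card) / n) = sc (trc X A) := rfl
  split_ifs with h
  · have : sc (trc X A) ^ 2 = 0 := by
      rw [hs2, ← hc1, ← hc0]; rcases h with h | h <;> simp [h]
    have : sc (trc X A) = 0 := by simpa using this
    simp [this]
  · push Not at h
    obtain ⟨h1, h2⟩ := h
    have h1 : (cnt X A : ℝ) ≠ 0 := by exact_mod_cast h1
    have h2 : (cnt X Aᶜ : ℝ) ≠ 0 := by exact_mod_cast h2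
    rw [sumIn_compl, e1]
    rw [hc1] at h2 ⊢
    rw [hc0] at h1 ⊢
    rw [hsd]
    generalize hs : sc (trc X A) = s at *
    generalize ((trc X A).card : ℝ) = a at *
    have hs0 : s ≠ 0 := by
      rintro rfl
      have : a * (n - a) / n ≠ 0 := div_ne_zero (mul_ne_zero h1 h2) hn'.ne'
      exact this (by rw [← hs2]; simp)
    rw [eq_div_iff hs0]
    generalize ∑ i ∈ trc X A, Z i = u
    generalize ∑ i, Z i = w
    calc s * (u / a - (w - u) / (n - a)) * s = s ^ 2 * (u / a - (w - u) / (n - a)) := by ring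
      _ = _ := by rw [hs2]; field_simp; ring

lemma loss_le {M : Type*} {n : ℕ} (hn : 0 < n) (X : Fin n → M) (A R : Set M)
    (hR1 : 0 < (trc X R).card) (hR2 : ((trc X R).card : ℝ) < n) :
    lossN X A R ≤ 1 - (∑ i, uv (trc X A) i * uv (trc X R) i) ^ 2 := by
  have hn' : (0 : ℝ) < n := by positivity
  set T := trc X A with hT
  set S := trc X R with hS
  have c1 : (cnt X (A ∆ R) : ℝ) = ((T \ S).card : ℝ) + ((S \ T).card : ℝ) := by
    rw [trc_card]
    have : trc X (A ∆ R) = (T \ S) ∪ (S \ T) := by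
      ext i; simp [trc, hT, hS, Set.mem_symmDiff]
    rw [this, Finset.card_union_of_disjoint]
    · push_cast; rfl
    · exact disjoint_sdiff_sdiff
  have c2 : (cnt X (A ∆ Rᶜ) : ℝ) = ((T ∩ S).card : ℝ) + (((T ∪ S)ᶜ).card : ℝ) := by
    rw [trc_card]
    have : trc X (A ∆ Rᶜ) = (T ∩ S) ∪ (T ∪ S)ᶜ := by
      ext i; simp [trc, hT, hS, Set.mem_symmDiff]; tauto
    rw [this, Finset.card_union_of_disjoint]
    · push_cast; rfl
    · rw [Finset.disjoint_left]; intro i; simp; tauto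
  have d1 : (T.card : ℝ) = ((T ∩ S).card : ℝ) + ((T \ S).card : ℝ) := by
    exact_mod_cast (Finset.card_inter_add_card_sdiff T S).symm
  have d2 : (S.card : ℝ) = ((T ∩ S).card : ℝ) + ((S \ T).card : ℝ) := by
    rw [Finset.inter_comm]
    exact_mod_cast (Finset.card_inter_add_card_sdiff S T).symm
  have d3 : (n : ℝ) = ((T ∩ S).card : ℝ) + ((T \ S).card : ℝ) + ((S \ T).card : ℝ)
      + (((T ∪ S)ᶜ).card : ℝ) := by
    have h1 := Finset.card_add_card_compl (T ∪ S)
    have h2 := Finset.card_union_add_card_inter T S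
    have h3 := Finset.card_inter_add_card_sdiff T S
    have h4 := Finset.card_inter_add_card_sdiff S T
    rw [Finset.inter_comm S T] at h4
    simp only [Fintype.card_fin] at h1
    have : n = (T ∩ S).card + (T \ S).card + (S \ T).card + ((T ∪ S)ᶜ).card := by omega
    exact_mod_cast this
  have hl : lossN X A R = min (((T \ S).card : ℝ) + ((S \ T).card : ℝ))
      (((T ∩ S).card : ℝ) + (((T ∪ S)ᶜ).card : ℝ)) / n := by
    unfold lossN; rw [c1, c2]; ring
  rw [hl, sum_uv_uv hn, div_pow, mul_pow, sc_sq, sc_sq]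
  have hR1' : (0 : ℝ) < S.card := by exact_mod_cast hR1
  have p0 : (0 : ℝ) ≤ (T ∩ S).card := by positivity
  have q0 : (0 : ℝ) ≤ (T \ S).card := by positivity
  have r0 : (0 : ℝ) ≤ (S \ T).card := by positivity
  have t0 : (0 : ℝ) ≤ ((T ∪ S)ᶜ).card := by positivity
  generalize ((T ∩ S).card : ℝ) = p at *
  generalize ((T \ S).card : ℝ) = q at *
  generalize ((S \ T).card : ℝ) = r at *
  generalize (((T ∪ S)ᶜ).card : ℝ) = t at *
  generalize (S.card : ℝ) = c at *
  generalize (T.card : ℝ) = a at *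
  generalize (n : ℝ) = N at *
  subst d1 d2 d3
  have hS' : 0 < q + t := by linarith
  have key := aux_ineq p q r t p0 q0 r0 t0 hR1' hS'
  have e1 : p + q + r + t - (p + q) = r + t := by ring
  have e2 : p + q + r + t - (p + r) = q + t := by ring
  rw [e1, e2]
  by_cases hz : (p + q) * (r + t) = 0
  · rw [hz]
    simp only [zero_div, zero_mul, div_zero, sub_zero]
    rw [div_le_one hn']
    exact (min_le_left _ _).trans (by linarith)
  · have hpos : 0 < (p + q) * (r + t) := lt_of_le_of_ne (by positivity) (Ne.symm hz)
    generalize min (q + r) (p + t) = m at *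
    have hid : 1 - (p - (p + q) * (p + r) / (p + q + r + t)) ^ 2 /
        ((p + q) * (r + t) / (p + q + r + t) * ((p + r) * (q + t) / (p + q + r + t))) =
        (p + q + r + t) * (p * r / (p + r) + q * t / (q + t)) / ((p + q) * (r + t)) := by
      have h1 : p + q ≠ 0 := fun h => hz (by rw [h]; simp)
      have h2 : r + t ≠ 0 := fun h => hz (by rw [h]; simp)
      field_simp
      ring
    rw [hid, div_le_div_iff₀ hn' hpos]
    nlinarith [key]

set_option maxHeartbeats 2000000

/-- Theorem 1 (single change region): with probability at least `1 − C₁ n^{−VCD(𝒜)}`, any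
maximiser of the absolute CUSUM statistic over the VC class `𝒜` estimates the change region
`R₁` with loss at most `C₂ σ² VCD(𝒜) log n / (n τ θ²)`, provided
`n τ θ² > C₀ σ² VCD(𝒜) log n`. -/
theorem statement4 :
    ∃ C₀ C₁ C₂ : ℝ, 0 < C₀ ∧ 0 < C₁ ∧ 0 < C₂ ∧
      ∀ (M : Type) (n : ℕ) (X : Fin n → M), Function.Injective X →
        ∀ (𝒜 : Set (Set M)) (v : ℕ), VCD 𝒜 = (v : ℕ∞) →
          ∀ R₁ ∈ 𝒜, ∀ μ₁ μ₀ σ θ τ : ℝ, 0 < σ →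
            θ = |μ₁ - μ₀| → τ = lossN X R₁ ∅ → 0 < τ →
            (n : ℝ) * τ * θ ^ 2 > C₀ * σ ^ 2 * (v : ℝ) * Real.log n →
            ∀ Rhat : (Fin n → ℝ) → Set M,
              (∀ y : Fin n → ℝ, Rhat y ∈ 𝒜 ∧ ∀ A ∈ 𝒜, |cusum X A y| ≤ |cusum X (Rhat y) y|) →
              ENNReal.ofReal (1 - C₁ / (n : ℝ) ^ v) ≤
                (Measure.pi fun _ : Fin n => gaussianReal 0 ⟨σ ^ 2, sq_nonneg σ⟩)
                  {ε : Fin n → ℝ |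
                    lossN X (Rhat fun i => (if X i ∈ R₁ then μ₁ else μ₀) + ε i) R₁ ≤
                      C₂ * σ ^ 2 * (v : ℝ) * Real.log n / ((n : ℝ) * τ * θ ^ 2)} := by
  
  refine ⟨1, 2, 48, by norm_num, by norm_num, by norm_num, ?_⟩
  intro M n X hX 𝒜 v hv R hR μ₁ μ₀ σ θ τ hσ hθ hτ hτ0 hcond Rhat hRhat
  have hn0 : 0 < n := by
    rcases Nat.eq_zero_or_pos n with h | h
    · subst h; simp [hτ, lossN] at hτ0
    · exact h
  have hn' : (0 : ℝ) < n := by exact_mod_cast hn0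
  have hτ' : (n : ℝ) * τ = min ((trc X R).card : ℝ) (n - (trc X R).card) := by
    rw [hτ]
    unfold lossN
    have e1 : R ∆ (∅ : Set M) = R := symmDiff_bot R
    have e2 : R ∆ (∅ : Set M)ᶜ = Rᶜ := by rw [Set.compl_empty]; exact symmDiff_top R
    rw [e1, e2, cnt_compl, trc_card]
    field_simp
  have hnτ : 0 < (n : ℝ) * τ := by positivity
  have hm : 0 < min ((trc X R).card : ℝ) (n - (trc X R).card) := hτ' ▸ hnτ
  have hR1' : (0 : ℝ) < (trc X R).card := lt_of_lt_of_le hm (min_le_left _ _)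
  have hR1 : 0 < (trc X R).card := by exact_mod_cast hR1'
  have hR2 : ((trc X R).card : ℝ) < n := by linarith [lt_of_lt_of_le hm (min_le_right _ _)]
  have hn2 : 2 ≤ n := by
    have : (trc X R).card < n := by exact_mod_cast hR2
    omega
  have hlog : 0 ≤ Real.log n := Real.log_natCast_nonneg n
  set t : ℝ := 3 * v * Real.log n with ht
  have ht0 : 0 ≤ t := by positivity
  have hθ0 : 0 < θ ^ 2 := by
    have h1 : 0 < (n : ℝ) * τ * θ ^ 2 := lt_of_le_of_lt (by positivity) hcond
    exact pos_of_mul_pos_right h1 hnτ.le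
  have hθpos : 0 < θ := by
    have : 0 ≤ θ := by rw [hθ]; positivity
    exact lt_of_le_of_ne this (by rintro rfl; simp at hθ0)
  obtain ⟨κ, hκ1, hκ⟩ : ∃ κ : ℝ, κ ^ 2 = 1 ∧ κ * (μ₁ - μ₀) = θ := by
    rcases le_total 0 (μ₁ - μ₀) with h | h
    · exact ⟨1, by norm_num, by rw [hθ, abs_of_nonneg h]; ring⟩
    · exact ⟨-1, by norm_num, by rw [hθ, abs_of_nonpos h]; ring⟩
  set S := trc X R with hS
  let z : Finset (Fin n) × ℝ → Fin n → ℝ := fun q i => q.2 * uv q.1 i - κ * uv S i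
  let bad : Finset (Fin n) × ℝ → Set (Fin n → ℝ) := fun q =>
    {ε | σ * Real.sqrt ((∑ i, z q i ^ 2) * (2 * t)) < ∑ i, z q i * ε i}
  let I : Finset (Finset (Fin n) × ℝ) := trcs X 𝒜 ×ˢ {1, -1}
  set P := (Measure.pi fun _ : Fin n => gaussianReal 0 ⟨σ ^ 2, sq_nonneg σ⟩) with hP
  have hPuniv : P Set.univ = 1 := by
    have : IsProbabilityMeasure (Measure.pi fun _ : Fin n => gaussianReal 0 (NNReal.mk (σ ^ 2) (sq_nonneg σ))) :=
      inferInstance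
    exact this.measure_univ
  have hbad : ∀ q, P (bad q) ≤ ENNReal.ofReal (Real.exp (-t)) := fun q =>
    aux_tail σ hσ (NNReal.mk (σ ^ 2) (sq_nonneg σ)) rfl (z q) t ht0
  have hcardI : I.card ≤ 2 * (n ^ 2) ^ v := by
    have h1 : I.card ≤ (n + 1) ^ v * 2 := by
      rw [Finset.card_product]
      exact Nat.mul_le_mul (aux_sauer X hX 𝒜 v hv) Finset.card_le_two
    have h2 : (n + 1) ^ v ≤ (n ^ 2) ^ v := Nat.pow_le_pow_left (by nlinarith) v
    omega
  have hU : P (⋃ q ∈ I, bad q) ≤ ENNReal.ofReal (2 / (n : ℝ) ^ v) := by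
    calc P (⋃ q ∈ I, bad q) ≤ ∑ q ∈ I, P (bad q) := measure_biUnion_finset_le _ _
      _ ≤ ∑ q ∈ I, ENNReal.ofReal (Real.exp (-t)) := Finset.sum_le_sum (fun q _ => hbad q)
      _ = ENNReal.ofReal (I.card * Real.exp (-t)) := by
        rw [Finset.sum_const, nsmul_eq_mul, ENNReal.ofReal_mul (by positivity), ENNReal.ofReal_natCast]
      _ ≤ _ := by
        apply ENNReal.ofReal_le_ofReal
        have he : Real.exp (-t) = (((n : ℝ) ^ v) ^ 3)⁻¹ := by
          rw [Real.exp_neg, ht]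
          congr 1
          rw [← pow_mul, ← Real.exp_log (pow_pos hn' (v * 3)), Real.log_pow]
          congr 1
          push_cast; ring
        have hc : (I.card : ℝ) ≤ 2 * ((n : ℝ) ^ v) ^ 2 := by
          have : (I.card : ℝ) ≤ ((2 * (n ^ 2) ^ v : ℕ) : ℝ) := by exact_mod_cast hcardI
          refine this.trans (le_of_eq ?_)
          push_cast; ring
        rw [he]
        have hw : 0 < (n : ℝ) ^ v := by positivity
        calc (I.card : ℝ) * (((n : ℝ) ^ v) ^ 3)⁻¹ ≤ 2 * ((n : ℝ) ^ v) ^ 2 * (((n : ℝ) ^ v) ^ 3)⁻¹ := by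
              gcongr
          _ = _ := by field_simp
  set G := {ε : Fin n → ℝ |
      lossN X (Rhat fun i => (if X i ∈ R then μ₁ else μ₀) + ε i) R ≤
        48 * σ ^ 2 * (v : ℝ) * Real.log n / ((n : ℝ) * τ * θ ^ 2)} with hG
  have hcover : Set.univ ⊆ G ∪ ⋃ q ∈ I, bad q := by
    intro ε _
    by_cases hε : ε ∈ ⋃ q ∈ I, bad q
    · exact Or.inr hε
    left
    simp only [Set.mem_iUnion, not_exists] at hε
    show lossN X (Rhat fun i => (if X i ∈ R then μ₁ else μ₀) + ε i) R ≤
        48 * σ ^ 2 * (v : ℝ) * Real.log n / ((n : ℝ) * τ * θ ^ 2)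
    set y : Fin n → ℝ := fun i => (if X i ∈ R then μ₁ else μ₀) + ε i with hy
    obtain ⟨hA, hmax⟩ := hRhat y
    have hmaxR := hmax R hR
    set A := Rhat y with hAdef
    obtain ⟨η, hη, hηc⟩ : ∃ η : ℝ, η ∈ ({1, -1} : Finset ℝ) ∧ η * cusum X A y = |cusum X A y| := by
      rcases le_total 0 (cusum X A y) with h | h
      · exact ⟨1, by simp, by rw [abs_of_nonneg h]; ring⟩
      · exact ⟨-1, by simp, by rw [abs_of_nonpos h]; ring⟩
    have hη1 : η ^ 2 = 1 := by
      rcases Finset.mem_insert.1 hη with h | h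
      · rw [h]; norm_num
      · rw [Finset.mem_singleton.1 h]; norm_num
    have hmem : (trc X A, η) ∈ I :=
      Finset.mem_product.2 ⟨Finset.mem_filter.2 ⟨Finset.mem_univ _, A, hA, rfl⟩, hη⟩
    have hnb : ∑ i, z (trc X A, η) i * ε i ≤
        σ * Real.sqrt ((∑ i, z (trc X A, η) i ^ 2) * (2 * t)) := not_lt.1 (hε _ hmem)
    have hloss := loss_le hn0 X A R hR1 hR2
    rw [← hS] at hloss
    set T := trc X A with hT
    set ρ := ∑ i, uv T i * uv S i with hρ
    have hsc2 := sc_sq S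
    have hscpos : 0 < sc S ^ 2 := by
      rw [hsc2]
      have : 0 < (n : ℝ) - S.card := by linarith
      positivity
    have hsc0 : 0 < sc S := by
      have : 0 ≤ sc S := Real.sqrt_nonneg _
      exact lt_of_le_of_ne this (fun h => by rw [← h] at hscpos; simp at hscpos)
    have hSS : ∑ i, uv S i ^ 2 = 1 := by
      rw [sum_uv_sq hn0, div_self hscpos.ne']
    have hTT := sum_uv_sq_le hn0 T
    have hyi : ∀ i, y i = (μ₀ + (μ₁ - μ₀) * (S.card / n)) + (μ₁ - μ₀) * sc S * uv S i + ε i := by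
      intro i
      have h1 : sc S * uv S i = ind S i - S.card / n := by
        unfold uv; field_simp
      rw [mul_assoc, h1, hy]
      have h2 : ind S i = if X i ∈ R then 1 else 0 := by
        simp [ind, hS, trc]
      rw [h2]
      simp only
      split_ifs <;> ring
    have hzsum : ∑ i, z (T, η) i = 0 := by
      simp only [z, Finset.sum_sub_distrib, ← Finset.mul_sum, sum_uv hn0]
      ring
    have hzS : ∑ i, z (T, η) i * uv S i = η * ρ - κ := by
      have : ∀ i, z (T, η) i * uv S i = η * (uv T i * uv S i) - κ * uv S i ^ 2 := by
        intro i; simp only [z]; ring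
      simp only [this, Finset.sum_sub_distrib, ← Finset.mul_sum, hSS, ← hρ]
      ring
    have hzy : ∑ i, z (T, η) i * y i = η * cusum X A y - κ * cusum X R y := by
      rw [cusum_eq hn0, cusum_eq hn0, Finset.mul_sum, Finset.mul_sum, ← Finset.sum_sub_distrib]
      apply Finset.sum_congr rfl
      intro i _
      simp only [z]; ring
    have hzy0 : 0 ≤ ∑ i, z (T, η) i * y i := by
      rw [hzy, hηc]
      have : κ * cusum X R y ≤ |cusum X R y| := by
        have hk : |κ| = 1 := by
          rcases (sq_eq_sq_iff_eq_or_eq_neg.1 (hκ1.trans (one_pow 2).symm)) with h | h <;> simp [h]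
        calc κ * cusum X R y ≤ |κ * cusum X R y| := le_abs_self _
          _ = _ := by rw [abs_mul, hk, one_mul]
      linarith
    have hzy2 : ∑ i, z (T, η) i * y i =
        (μ₁ - μ₀) * sc S * (η * ρ - κ) + ∑ i, z (T, η) i * ε i := by
      have : ∀ i, z (T, η) i * y i = (μ₀ + (μ₁ - μ₀) * (S.card / n)) * z (T, η) i
          + (μ₁ - μ₀) * sc S * (z (T, η) i * uv S i) + z (T, η) i * ε i := by
        intro i; rw [hyi]; ring
      simp only [this, Finset.sum_add_distrib, ← Finset.mul_sum, hzsum, hzS]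
      ring
    set x := 1 - η * κ * ρ with hx
    have hz2 : ∑ i, z (T, η) i ^ 2 ≤ 2 * x := by
      have : ∀ i, z (T, η) i ^ 2 = uv T i ^ 2 - 2 * η * κ * (uv T i * uv S i) + uv S i ^ 2 := by
        intro i; simp only [z]
        linear_combination (uv T i ^ 2) * hη1 + (uv S i ^ 2) * hκ1
      simp only [this, Finset.sum_add_distrib, Finset.sum_sub_distrib, ← Finset.mul_sum, hSS, ← hρ]
      rw [hx]; linarith
    have hx0 : 0 ≤ x := by
      have : 0 ≤ ∑ i, z (T, η) i ^ 2 := Finset.sum_nonneg (fun i _ => sq_nonneg _)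
      linarith
    have hLx : lossN X A R ≤ 2 * x := by
      have h1 : (η * κ * ρ) ^ 2 = ρ ^ 2 := by rw [mul_pow, mul_pow, hη1, hκ1]; ring
      have h2 : η * κ * ρ = 1 - x := by rw [hx]; ring
      rw [h2] at h1
      nlinarith [sq_nonneg x]
    have hmain : θ * sc S * x ≤ σ * Real.sqrt (2 * x * (2 * t)) := by
      have h1 : (μ₁ - μ₀) * sc S * (η * ρ - κ) = - (θ * sc S * x) := by
        rw [hx, ← hκ]
        linear_combination (-(μ₁ - μ₀) * sc S * η * ρ) * hκ1
      have h2 : Real.sqrt ((∑ i, z (T, η) i ^ 2) * (2 * t)) ≤ Real.sqrt (2 * x * (2 * t)) := by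
        apply Real.sqrt_le_sqrt
        gcongr
      have h3 := mul_le_mul_of_nonneg_left h2 hσ.le
      linarith
    have hsq : (θ * sc S * x) ^ 2 ≤ σ ^ 2 * (2 * x * (2 * t)) := by
      have := pow_le_pow_left₀ (by positivity) hmain 2
      rwa [mul_pow σ, Real.sq_sqrt (by positivity)] at this
    have hfin : θ ^ 2 * sc S ^ 2 * x ≤ 4 * σ ^ 2 * t := by
      rcases hx0.eq_or_lt with h | h
      · rw [← h]; simp only [mul_zero]; positivity
      · have : (θ ^ 2 * sc S ^ 2 * x) * x ≤ (4 * σ ^ 2 * t) * x := by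
          calc _ = (θ * sc S * x) ^ 2 := by ring
            _ ≤ _ := hsq
            _ = _ := by ring
        exact le_of_mul_le_mul_right this h
    have hscτ : (n : ℝ) * τ ≤ 2 * sc S ^ 2 := by
      rw [hτ', hsc2, ← mul_div_assoc, le_div_iff₀ hn']
      rcases le_total (S.card : ℝ) (n - S.card) with h | h
      · rw [min_eq_left h]; nlinarith
      · rw [min_eq_right h]; nlinarith
    rw [le_div_iff₀ (by positivity)]
    calc lossN X A R * ((n : ℝ) * τ * θ ^ 2) ≤ (2 * x) * (2 * sc S ^ 2 * θ ^ 2) := by gcongr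
      _ = 4 * (θ ^ 2 * sc S ^ 2 * x) := by ring
      _ ≤ 4 * (4 * σ ^ 2 * t) := by gcongr
      _ = _ := by rw [ht]; ring
  have hfinal : (1 : ℝ≥0∞) ≤ P G + ENNReal.ofReal (2 / (n : ℝ) ^ v) := by
    rw [← hPuniv]
    exact (measure_mono hcover).trans ((measure_union_le _ _).trans (by gcongr))
  rw [ENNReal.ofReal_sub _ (by positivity), ENNReal.ofReal_one]
  exact tsub_le_iff_right.2 hfinal
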